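/- Logarithmic approximation of average-link for cs-ratio_DM: for every k ≥ 2 and every execution of average-link on a finite metric space with n distinct points, cs-ratio_DM(A^k) ≤ 6·H_n · OPT, where OPT is the minimum of cs-ratio_DM(C) over all k-clusterings C of X. -/

import Mathlib

open Finset

/-- Average distance between two finite sets of points. -/
noncomputable def avgD {X : Type*} (d : X → X → ℝ) (A B : Finset X) : ℝ :=
  (∑ a ∈ A, ∑ b ∈ B, d a b) / ((A.card : ℝ) * (B.card : ℝ))

/-- The diameter of a finite set. -/
noncomputable def diamF {X : Type*} (d : X → X → ℝ) (C : Finset X) : ℝ :=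
  sSup {r : ℝ | ∃ x ∈ C, ∃ y ∈ C, r = d x y}

/-- `sep_min(𝒞) = min_{A ≠ B ∈ 𝒞} avg(A,B)`. -/
noncomputable def sepMin {X : Type*} (d : X → X → ℝ) (𝒞 : Finset (Finset X)) : ℝ :=
  sInf {r : ℝ | ∃ A ∈ 𝒞, ∃ B ∈ 𝒞, A ≠ B ∧ r = avgD d A B}

/-- `max-diam(𝒞) = max_{C ∈ 𝒞} diam(C)`. -/
noncomputable def maxDiam {X : Type*} (d : X → X → ℝ) (𝒞 : Finset (Finset X)) : ℝ :=
  sSup {r : ℝ | ∃ C ∈ 𝒞, r = diamF d C}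

/-- `cs-ratio_DM(𝒞) = max-diam(𝒞) / sep_min(𝒞)`. -/
noncomputable def csRatioDM {X : Type*} (d : X → X → ℝ) (𝒞 : Finset (Finset X)) : ℝ :=
  maxDiam d 𝒞 / sepMin d 𝒞

/-- A `k`-clustering of `X`: a partition of all points of `X` into `k` nonempty clusters. -/
def IsClustering {X : Type*} (𝒞 : Finset (Finset X)) (k : ℕ) : Prop :=
  𝒞.card = k ∧ (∀ C ∈ 𝒞, C.Nonempty) ∧
    (∀ C ∈ 𝒞, ∀ C' ∈ 𝒞, C ≠ C' → Disjoint C C') ∧ (∀ x : X, ∃ C ∈ 𝒞, x ∈ C)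

/-- The `p`-th harmonic number `H_p = Σ_{i=1}^p 1/i`. -/
noncomputable def harmonicR (p : ℕ) : ℝ := ∑ i ∈ Finset.range p, (1 : ℝ) / (i + 1)

/-- An execution of average-link. -/
structure AvgLinkExec (X : Type*) [Fintype X] [DecidableEq X] (d : X → X → ℝ) where
  part : ℕ → Finset (Finset X)
  init : part (Fintype.card X) = Finset.univ.image (fun x : X => ({x} : Finset X))
  merge : ∀ k : ℕ, 1 ≤ k → k < Fintype.card X →
    ∃ A ∈ part (k + 1), ∃ B ∈ part (k + 1), A ≠ B ∧
      (∀ A' ∈ part (k + 1), ∀ B' ∈ part (k + 1), A' ≠ B' → avgD d A B ≤ avgD d A' B') ∧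
      part k = insert (A ∪ B) (((part (k + 1)).erase A).erase B)

section Harmonic

lemma harmonicR_nonneg (p : ℕ) : 0 ≤ harmonicR p :=
  Finset.sum_nonneg fun i _ => by positivity

lemma harmonicR_mono {p q : ℕ} (h : p ≤ q) : harmonicR p ≤ harmonicR q :=
  Finset.sum_le_sum_of_subset_of_nonneg (Finset.range_mono h) fun i _ _ => by positivity

lemma one_le_harmonicR {p : ℕ} (hp : 1 ≤ p) : 1 ≤ harmonicR p := by
  have h := harmonicR_mono hp
  simpa [harmonicR] using h

/-- Each of the last `t` terms of `H_{s+t}` is at least `1 / (s + t)`. -/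
lemma le_mul_harmonicR_sub (s t : ℕ) :
    (t : ℝ) ≤ ((s : ℝ) + t) * (harmonicR (s + t) - harmonicR s) := by
  induction t with
  | zero => simp
  | succ t ih =>
    have e : harmonicR (s + (t + 1)) = harmonicR (s + t) + 1 / ((s : ℝ) + t + 1) := by
      rw [← add_assoc, harmonicR, Finset.sum_range_succ, harmonicR]; push_cast; rfl
    have hm := harmonicR_mono (Nat.le_add_right s t)
    have hpos : (0 : ℝ) < (s : ℝ) + t + 1 := by positivity
    rw [e]; push_cast
    have : ((s : ℝ) + t + 1) * (1 / ((s : ℝ) + t + 1)) = 1 := by field_simp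
    nlinarith

end Harmonic

section Average

variable {X : Type*} {d : X → X → ℝ} {A B : Finset X} {c : ℝ}

lemma avgD_mul_card (hA : A.Nonempty) (hB : B.Nonempty) :
    avgD d A B * ((A.card : ℝ) * B.card) = ∑ a ∈ A, ∑ b ∈ B, d a b := by
  have hA' : (0 : ℝ) < A.card := by exact_mod_cast hA.card_pos
  have hB' : (0 : ℝ) < B.card := by exact_mod_cast hB.card_pos
  unfold avgD; field_simp

lemma avgD_le_of_forall_le (hA : A.Nonempty) (hB : B.Nonempty)
    (h : ∀ a ∈ A, ∀ b ∈ B, d a b ≤ c) : avgD d A B ≤ c := by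
  have hA' : (0 : ℝ) < A.card := by exact_mod_cast hA.card_pos
  have hB' : (0 : ℝ) < B.card := by exact_mod_cast hB.card_pos
  unfold avgD
  rw [div_le_iff₀ (by positivity)]
  calc _ ≤ ∑ a ∈ A, ∑ b ∈ B, c :=
        Finset.sum_le_sum fun a ha => Finset.sum_le_sum fun b hb => h a ha b hb
    _ = _ := by simp; ring

lemma lt_avgD_of_forall_lt (hA : A.Nonempty) (hB : B.Nonempty)
    (h : ∀ a ∈ A, ∀ b ∈ B, c < d a b) : c < avgD d A B := by
  have hA' : (0 : ℝ) < A.card := by exact_mod_cast hA.card_pos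
  have hB' : (0 : ℝ) < B.card := by exact_mod_cast hB.card_pos
  unfold avgD
  rw [lt_div_iff₀ (by positivity)]
  calc _ = ∑ a ∈ A, ∑ b ∈ B, c := by simp; ring
    _ < _ := Finset.sum_lt_sum_of_nonempty hA fun a ha =>
        Finset.sum_lt_sum_of_nonempty hB fun b hb => h a ha b hb

lemma avgD_comm (hd : ∀ x y, d x y = d y x) (A B : Finset X) : avgD d A B = avgD d B A := by
  unfold avgD
  rw [Finset.sum_comm, mul_comm]
  simp_rw [hd]

/-- The average distance to a union of two disjoint sets is a mean of the two averages. -/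
lemma le_avgD_union [DecidableEq X] {C : Finset X} (hA : A.Nonempty) (hB : B.Nonempty)
    (hC : C.Nonempty) (hAB : Disjoint A B) (h₁ : c ≤ avgD d A C) (h₂ : c ≤ avgD d B C) :
    c ≤ avgD d (A ∪ B) C := by
  have hA' : (0 : ℝ) < A.card := by exact_mod_cast hA.card_pos
  have hB' : (0 : ℝ) < B.card := by exact_mod_cast hB.card_pos
  have hC' : (0 : ℝ) < C.card := by exact_mod_cast hC.card_pos
  have e₁ := avgD_mul_card (d := d) hA hC
  have e₂ := avgD_mul_card (d := d) hB hC
  rw [avgD, Finset.sum_union hAB, Finset.card_union_of_disjoint hAB, ← e₁, ← e₂]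
  push_cast
  rw [le_div_iff₀ (by positivity)]
  have := mul_le_mul_of_nonneg_right h₁ (mul_pos hA' hC').le
  have := mul_le_mul_of_nonneg_right h₂ (mul_pos hB' hC').le
  linarith

end Average

section Extrema

variable {X : Type*} [Finite X] (d : X → X → ℝ)

lemma le_diamF {C : Finset X} {x y : X} (hx : x ∈ C) (hy : y ∈ C) : d x y ≤ diamF d C := by
  refine le_csSup (Set.Finite.bddAbove ?_) ⟨x, hx, y, hy, rfl⟩
  refine (Set.finite_range fun p : X × X => d p.1 p.2).subset ?_
  rintro _ ⟨x, -, y, -, rfl⟩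
  exact ⟨(x, y), rfl⟩

lemma diamF_le_maxDiam {𝒞 : Finset (Finset X)} {C : Finset X} (hC : C ∈ 𝒞) :
    diamF d C ≤ maxDiam d 𝒞 := by
  refine le_csSup (Set.Finite.bddAbove ?_) ⟨C, hC, rfl⟩
  refine (Set.finite_range (diamF d)).subset ?_
  rintro _ ⟨C, -, rfl⟩
  exact ⟨C, rfl⟩

lemma finite_avgD_pairs (𝒞 : Finset (Finset X)) :
    {r : ℝ | ∃ A ∈ 𝒞, ∃ B ∈ 𝒞, A ≠ B ∧ r = avgD d A B}.Finite := by
  refine (Set.finite_range fun p : Finset X × Finset X => avgD d p.1 p.2).subset ?_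
  rintro _ ⟨A, -, B, -, -, rfl⟩
  exact ⟨(A, B), rfl⟩

lemma sepMin_le_avgD {𝒞 : Finset (Finset X)} {A B : Finset X} (hA : A ∈ 𝒞) (hB : B ∈ 𝒞)
    (hAB : A ≠ B) : sepMin d 𝒞 ≤ avgD d A B :=
  csInf_le (finite_avgD_pairs d 𝒞).bddBelow ⟨A, hA, B, hB, hAB, rfl⟩

lemma exists_sepMin_eq_avgD {𝒞 : Finset (Finset X)} (h : 1 < 𝒞.card) :
    ∃ A ∈ 𝒞, ∃ B ∈ 𝒞, A ≠ B ∧ sepMin d 𝒞 = avgD d A B := by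
  obtain ⟨A, hA, B, hB, hAB⟩ := Finset.one_lt_card.mp h
  have hne : {r : ℝ | ∃ A ∈ 𝒞, ∃ B ∈ 𝒞, A ≠ B ∧ r = avgD d A B}.Nonempty :=
    ⟨_, A, hA, B, hB, hAB, rfl⟩
  exact hne.csInf_mem (finite_avgD_pairs d 𝒞)

end Extrema

section Merging

variable {X : Type*} [DecidableEq X]

lemma IsClustering.merge {𝒞 : Finset (Finset X)} {m : ℕ} (h : IsClustering 𝒞 (m + 1))
    {A B : Finset X} (hA : A ∈ 𝒞) (hB : B ∈ 𝒞) (hAB : A ≠ B) :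
    IsClustering (insert (A ∪ B) ((𝒞.erase A).erase B)) m := by
  obtain ⟨hcard, hne, hdisj, hcov⟩ := h
  have hU : ∀ C ∈ (𝒞.erase A).erase B, Disjoint (A ∪ B) C := by
    intro C hC
    simp only [Finset.mem_erase] at hC
    exact Finset.disjoint_union_left.mpr
      ⟨hdisj A hA C hC.2.2 (Ne.symm hC.2.1), hdisj B hB C hC.2.2 (Ne.symm hC.1)⟩
  have hUne : (A ∪ B).Nonempty := (hne A hA).mono Finset.subset_union_left
  refine ⟨?_, ?_, ?_, ?_⟩
  · rw [Finset.card_insert_of_notMem, Finset.card_erase_of_mem, Finset.card_erase_of_mem hA]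
    · have := Finset.one_lt_card.mpr ⟨A, hA, B, hB, hAB⟩
      omega
    · exact Finset.mem_erase.mpr ⟨hAB.symm, hB⟩
    · intro hmem
      exact hUne.ne_empty (Finset.disjoint_self_iff_empty _ |>.mp (hU _ hmem))
  · intro C hC
    rcases Finset.mem_insert.mp hC with rfl | hC
    · exact hUne
    · exact hne C (Finset.mem_of_mem_erase (Finset.mem_of_mem_erase hC))
  · intro C hC C' hC' hCC'
    rcases Finset.mem_insert.mp hC with rfl | hC <;> rcases Finset.mem_insert.mp hC' with rfl | hC'
    · exact absurd rfl hCC'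
    · exact hU _ hC'
    · exact (hU _ hC).symm
    · exact hdisj C (Finset.mem_of_mem_erase (Finset.mem_of_mem_erase hC)) C'
        (Finset.mem_of_mem_erase (Finset.mem_of_mem_erase hC')) hCC'
  · intro x
    obtain ⟨C, hC, hx⟩ := hcov x
    by_cases h : C = A ∨ C = B
    · refine ⟨A ∪ B, Finset.mem_insert_self _ _, ?_⟩
      rcases h with rfl | rfl <;> simp [hx]
    · push Not at h
      exact ⟨C, Finset.mem_insert_of_mem
        (Finset.mem_erase.mpr ⟨h.2, Finset.mem_erase.mpr ⟨h.1, hC⟩⟩), hx⟩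

/-- Two clusterings of equal size, one refining the other, coincide. -/
lemma IsClustering.eq_of_refines {𝒟 𝒞 : Finset (Finset X)} {k : ℕ} (hP : IsClustering 𝒟 k)
    (hC : IsClustering 𝒞 k) (href : ∀ P ∈ 𝒟, ∃ Q ∈ 𝒞, P ⊆ Q) : 𝒟 = 𝒞 := by
  choose! f hf hsub using href
  have heq : ∀ Q ∈ 𝒞, ∀ P ∈ 𝒟, ∀ x ∈ P, x ∈ Q → f P = Q := by
    intro Q hQ P hP' x hxP hxQ
    by_contra hne
    exact Finset.disjoint_left.mp (hC.2.2.1 _ (hf P hP') Q hQ hne) (hsub P hP' hxP) hxQ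
  have hsurj : Set.SurjOn f 𝒟 𝒞 := by
    intro Q hQ
    obtain ⟨x, hx⟩ := hC.2.1 Q hQ
    obtain ⟨P, hP', hxP⟩ := hP.2.2.2 x
    exact ⟨P, hP', heq Q hQ P hP' x hxP hx⟩
  have hinj : Set.InjOn f 𝒟 :=
    Finset.injOn_of_surjOn_of_card_le f hf hsurj (hP.1.trans hC.1.symm).le
  refine Finset.eq_of_subset_of_card_le (fun P hP' => ?_) (hC.1.trans hP.1.symm).le
  suffices P = f P by rw [this]; exact hf P hP'
  refine (hsub P hP').antisymm fun x hx => ?_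
  obtain ⟨P', hP'', hxP⟩ := hP.2.2.2 x
  rwa [hinj hP' hP'' (heq _ (hf P hP') P' hP'' x hxP hx).symm]

variable [Fintype X]

lemma isClustering_singletons :
    IsClustering (Finset.univ.image fun x : X => ({x} : Finset X)) (Fintype.card X) := by
  refine ⟨?_, ?_, ?_, ?_⟩
  · rw [Finset.card_image_of_injective _ Finset.singleton_injective, Finset.card_univ]
  · simp
  · simp [eq_comm]
  · intro x
    exact ⟨{x}, by simp, by simp⟩

lemma AvgLinkExec.isClustering {d : X → X → ℝ} (E : AvgLinkExec X d) {m : ℕ} (hm : 1 ≤ m)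
    (hmn : m ≤ Fintype.card X) : IsClustering (E.part m) m := by
  induction hmn using Nat.decreasingInduction with
  | self => rw [E.init]; exact isClustering_singletons
  | of_succ m hmn ih =>
    obtain ⟨A, hA, B, hB, hAB, -, e⟩ := E.merge m hm hmn
    rw [e]
    exact (ih (by omega)).merge hA hB hAB

end Merging

section Metric

variable {X : Type*} [MetricSpace X]

lemma csRatioDM_nonneg (𝒞 : Finset (Finset X)) : 0 ≤ csRatioDM dist 𝒞 := by
  refine div_nonneg (Real.sSup_nonneg ?_) (Real.sInf_nonneg ?_)
  · rintro _ ⟨C, -, rfl⟩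
    refine Real.sSup_nonneg ?_
    rintro _ ⟨x, -, y, -, rfl⟩
    exact dist_nonneg
  · rintro _ ⟨A, -, B, -, -, rfl⟩
    unfold avgD; positivity

lemma IsClustering.sepMin_pos [Finite X] {𝒞 : Finset (Finset X)} {k : ℕ} (h : IsClustering 𝒞 k)
    (hk2 : 2 ≤ k) : 0 < sepMin dist 𝒞 := by
  obtain ⟨A, hA, B, hB, hAB, e⟩ := exists_sepMin_eq_avgD dist (𝒞 := 𝒞) (by rw [h.1]; omega)
  rw [e]
  refine lt_avgD_of_forall_lt (h.2.1 A hA) (h.2.1 B hB) fun a ha b hb => dist_pos.mpr ?_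
  rintro rfl
  exact Finset.disjoint_left.mp (h.2.2.1 A hA B hB hAB) ha hb

lemma sum_dist_union_le [DecidableEq X] {S T : Finset X} (hS : S.Nonempty) (hT : T.Nonempty)
    (hST : Disjoint S T) {v w : ℝ} (hv : avgD dist S T = v) (hwv : w ≤ v) (hv0 : 0 ≤ v) {x : X}
    (hx : ∑ y ∈ S, dist x y ≤ S.card * (w * harmonicR S.card)) :
    ∑ y ∈ S ∪ T, dist x y ≤ (S ∪ T).card * (v * harmonicR (S ∪ T).card) := by
  have hS' : (0 : ℝ) < S.card := by exact_mod_cast hS.card_pos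
  have hT' : (0 : ℝ) < T.card := by exact_mod_cast hT.card_pos
  have e := avgD_mul_card (d := dist) hS hT
  rw [hv] at e
  rw [Finset.sum_union hST, Finset.card_union_of_disjoint hST]
  have htri : (S.card : ℝ) * ∑ y ∈ T, dist x y
      ≤ T.card * ∑ y ∈ S, dist x y + v * (S.card * T.card) := by
    calc (S.card : ℝ) * ∑ y ∈ T, dist x y = ∑ s ∈ S, ∑ t ∈ T, dist x t := by simp
      _ ≤ ∑ s ∈ S, ∑ t ∈ T, (dist x s + dist s t) :=
        Finset.sum_le_sum fun s _ => Finset.sum_le_sum fun t _ => dist_triangle _ _ _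
      _ = _ := by simp [Finset.sum_add_distrib, ← Finset.mul_sum, e]
  have hx' : ∑ y ∈ S, dist x y ≤ S.card * (v * harmonicR S.card) :=
    hx.trans (by gcongr; exact harmonicR_nonneg _)
  have hharm := mul_le_mul_of_nonneg_left (le_mul_harmonicR_sub S.card T.card) hv0
  push_cast
  refine le_of_mul_le_mul_left ?_ hS'
  have h₁ := mul_le_mul_of_nonneg_left hx' (add_pos hS' hT').le
  have h₂ := mul_le_mul_of_nonneg_left hharm hS'.le
  linarith

variable [Fintype X] [DecidableEq X]

/-- Some value `v` bounds all separations of an average-link clustering from below while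
`v * H_|S|` bounds the average distance from any point to its cluster `S`. -/
lemma AvgLinkExec.exists_separation_cohesion (E : AvgLinkExec X dist) {m : ℕ} (hm : 1 ≤ m)
    (hmn : m ≤ Fintype.card X) :
    ∃ v : ℝ, 0 ≤ v ∧ (∀ A ∈ E.part m, ∀ B ∈ E.part m, A ≠ B → v ≤ avgD dist A B) ∧
      ∀ S ∈ E.part m, ∀ x ∈ S, ∑ y ∈ S, dist x y ≤ S.card * (v * harmonicR S.card) := by
  induction hmn using Nat.decreasingInduction with
  | self =>
    refine ⟨0, le_rfl, fun A _ B _ _ => ?_, ?_⟩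
    · unfold avgD; positivity
    · rw [E.init]; simp
  | of_succ m hmn ih =>
    obtain ⟨w, hw0, hsep, hcoh⟩ := ih (by omega)
    obtain ⟨-, hne, hdisj, -⟩ := E.isClustering (m := m + 1) (by omega) hmn
    obtain ⟨A, hA, B, hB, hAB, hmin, e⟩ := E.merge m hm hmn
    have hwv := hsep A hA B hB hAB
    have hU : ∀ C ∈ ((E.part (m + 1)).erase A).erase B, avgD dist A B ≤ avgD dist (A ∪ B) C := by
      intro C hC
      simp only [Finset.mem_erase] at hC
      exact le_avgD_union (hne A hA) (hne B hB) (hne C hC.2.2) (hdisj A hA B hB hAB)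
        (hmin A hA C hC.2.2 (Ne.symm hC.2.1)) (hmin B hB C hC.2.2 (Ne.symm hC.1))
    have hold : ∀ C ∈ ((E.part (m + 1)).erase A).erase B, C ∈ E.part (m + 1) := fun C hC =>
      Finset.mem_of_mem_erase (Finset.mem_of_mem_erase hC)
    refine ⟨avgD dist A B, hw0.trans hwv, ?_, ?_⟩ <;> rw [e]
    · intro C hC C' hC' hCC'
      rcases Finset.mem_insert.mp hC with rfl | hC <;>
        rcases Finset.mem_insert.mp hC' with rfl | hC'
      · exact absurd rfl hCC'
      · exact hU _ hC'
      · rw [avgD_comm dist_comm C]; exact hU _ hC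
      · exact hmin C (hold C hC) C' (hold C' hC') hCC'
    · intro S hS x hx
      rcases Finset.mem_insert.mp hS with rfl | hS
      · rcases Finset.mem_union.mp hx with hx | hx
        · exact sum_dist_union_le (hne A hA) (hne B hB) (hdisj A hA B hB hAB) rfl hwv
            (hw0.trans hwv) (hcoh A hA x hx)
        · rw [Finset.union_comm]
          exact sum_dist_union_le (hne B hB) (hne A hA) (hdisj B hB A hA hAB.symm)
            (avgD_comm dist_comm B A) hwv (hw0.trans hwv) (hcoh B hB x hx)
      · refine (hcoh S (hold S hS) x hx).trans ?_
        gcongr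
        exact harmonicR_nonneg _

/-- The cs-ratio of an average-link clustering is at most `2 H_n`. -/
lemma AvgLinkExec.csRatioDM_le (E : AvgLinkExec X dist) {k : ℕ} (hk2 : 2 ≤ k)
    (hkn : k ≤ Fintype.card X) :
    csRatioDM dist (E.part k) ≤ 2 * harmonicR (Fintype.card X) := by
  obtain ⟨v, hv0, hsep, hcoh⟩ := E.exists_separation_cohesion (by omega) hkn
  have hcl := E.isClustering (by omega) hkn
  have hvs : v ≤ sepMin dist (E.part k) := by
    obtain ⟨A, hA, B, hB, hAB, e⟩ := exists_sepMin_eq_avgD dist (by rw [hcl.1]; omega)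
    rw [e]; exact hsep A hA B hB hAB
  have hH := harmonicR_nonneg (Fintype.card X)
  have hdist : ∀ S ∈ E.part k, ∀ x ∈ S, ∀ y ∈ S,
      dist x y ≤ 2 * harmonicR (Fintype.card X) * v := by
    intro S hS x hx y hy
    have hS' : (0 : ℝ) < S.card := by exact_mod_cast Finset.card_pos.mpr ⟨x, hx⟩
    refine le_of_mul_le_mul_left ?_ hS'
    calc (S.card : ℝ) * dist x y = ∑ z ∈ S, dist x y := by simp
      _ ≤ ∑ z ∈ S, (dist x z + dist y z) :=
        Finset.sum_le_sum fun z _ => dist_triangle_right _ _ _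
      _ = ∑ z ∈ S, dist x z + ∑ z ∈ S, dist y z := Finset.sum_add_distrib
      _ ≤ S.card * (v * harmonicR S.card) + S.card * (v * harmonicR S.card) :=
        add_le_add (hcoh S hS x hx) (hcoh S hS y hy)
      _ = S.card * (2 * harmonicR S.card * v) := by ring
      _ ≤ _ := by gcongr; exact harmonicR_mono (Finset.card_le_univ S)
  have hmax : maxDiam dist (E.part k) ≤ 2 * harmonicR (Fintype.card X) * v := by
    refine Real.sSup_le ?_ (by positivity)
    rintro _ ⟨S, hS, rfl⟩
    refine Real.sSup_le ?_ (by positivity)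
    rintro _ ⟨x, hx, y, hy, rfl⟩
    exact hdist S hS x hx y hy
  exact div_le_of_le_mul₀ (hv0.trans hvs) (by positivity) (hmax.trans (by gcongr))

/-- Average-link recovers every clustering whose separation exceeds three times its diameter. -/
lemma AvgLinkExec.eq_of_three_mul_maxDiam_lt (E : AvgLinkExec X dist) {k : ℕ} (hk : 1 ≤ k)
    (hkn : k ≤ Fintype.card X) {𝒞 : Finset (Finset X)} (h𝒞 : IsClustering 𝒞 k)
    (hD : 3 * maxDiam dist 𝒞 < sepMin dist 𝒞) : E.part k = 𝒞 := by
  have hin : ∀ Q ∈ 𝒞, ∀ x ∈ Q, ∀ y ∈ Q, dist x y ≤ maxDiam dist 𝒞 := fun Q hQ x hx y hy =>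
    (le_diamF dist hx hy).trans (diamF_le_maxDiam dist hQ)
  have hout : ∀ Q ∈ 𝒞, ∀ R ∈ 𝒞, Q ≠ R → ∀ x ∈ Q, ∀ y ∈ R, maxDiam dist 𝒞 < dist x y := by
    intro Q hQ R hR hQR x hx y hy
    have h₁ := sepMin_le_avgD dist hQ hR hQR
    have h₂ : avgD dist Q R ≤ dist x y + 2 * maxDiam dist 𝒞 := by
      refine avgD_le_of_forall_le (h𝒞.2.1 Q hQ) (h𝒞.2.1 R hR) fun a ha b hb => ?_
      have := dist_triangle4 a x y b
      have := hin Q hQ a ha x hx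
      have := hin R hR y hy b hb
      linarith
    linarith
  refine (E.isClustering hk hkn).eq_of_refines h𝒞 ?_
  have href : ∀ m, k ≤ m → m ≤ Fintype.card X → ∀ P ∈ E.part m, ∃ Q ∈ 𝒞, P ⊆ Q := by
    intro m hkm hmn
    induction hmn using Nat.decreasingInduction with
    | self =>
      rw [E.init]
      intro P hP
      obtain ⟨x, -, rfl⟩ := Finset.mem_image.mp hP
      obtain ⟨Q, hQ, hx⟩ := h𝒞.2.2.2 x
      exact ⟨Q, hQ, Finset.singleton_subset_iff.mpr hx⟩
    | of_succ m hmn ih =>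
      have href := ih (by omega)
      have hcl := E.isClustering (m := m + 1) (by omega) hmn
      obtain ⟨A, hA, B, hB, hAB, hmin, e⟩ := E.merge m (by omega) hmn
      have hle : avgD dist A B ≤ maxDiam dist 𝒞 := by
        choose! f hf hsub using href
        obtain ⟨P, hP, P', hP', hne, hPP'⟩ := Finset.exists_ne_map_eq_of_card_lt_of_maps_to
          (s := E.part (m + 1)) (t := 𝒞) (by rw [hcl.1, h𝒞.1]; omega) hf
        refine (hmin P hP P' hP' hne).trans ?_
        refine avgD_le_of_forall_le (hcl.2.1 P hP) (hcl.2.1 P' hP') fun a ha b hb => ?_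
        exact hin (f P) (hf P hP) a (hsub P hP ha) b (hPP' ▸ hsub P' hP' hb)
      obtain ⟨Q, hQ, hAQ⟩ := href A hA
      obtain ⟨R, hR, hBR⟩ := href B hB
      have hQR : Q = R := by
        by_contra hQR
        exact hle.not_gt (lt_avgD_of_forall_lt (hcl.2.1 A hA) (hcl.2.1 B hB)
          fun a ha b hb => hout Q hQ R hR hQR a (hAQ ha) b (hBR hb))
      subst hQR
      rw [e]
      intro P hP
      rcases Finset.mem_insert.mp hP with rfl | hP
      · exact ⟨Q, hQ, Finset.union_subset hAQ hBR⟩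
      · exact href P (Finset.mem_of_mem_erase (Finset.mem_of_mem_erase hP))
  exact href k le_rfl hkn

end Metric

/-- Logarithmic approximation of average-link for `cs-ratio_DM`: for every `k ≥ 2` and every
execution of average-link on a finite metric space with `n` (distinct) points,
`cs-ratio_DM(A^k) ≤ 6·H_n · OPT`, where `OPT` is the minimum of `cs-ratio_DM` over all
`k`-clusterings of `X`. -/
theorem avgLink_csRatioDM_log_approx {X : Type*} [MetricSpace X] [Fintype X] [DecidableEq X]
    (E : AvgLinkExec X dist) (k : ℕ) (hk2 : 2 ≤ k) (hkn : k ≤ Fintype.card X) :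
    csRatioDM dist (E.part k)
      ≤ 6 * harmonicR (Fintype.card X) *
          sInf {r : ℝ | ∃ 𝒞 : Finset (Finset X), IsClustering 𝒞 k ∧ r = csRatioDM dist 𝒞} := by
  have hH := one_le_harmonicR (p := Fintype.card X) (by omega)
  have hpos : 0 < 6 * harmonicR (Fintype.card X) := by linarith
  rw [← div_le_iff₀' hpos]
  refine le_csInf ⟨_, E.part k, E.isClustering (by omega) hkn, rfl⟩ ?_
  rintro _ ⟨𝒞, h𝒞, rfl⟩
  rw [div_le_iff₀' hpos]
  rcases lt_or_ge (3 * maxDiam dist 𝒞) (sepMin dist 𝒞) with hlt | hge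
  · rw [E.eq_of_three_mul_maxDiam_lt (by omega) hkn h𝒞 hlt]
    exact le_mul_of_one_le_left (csRatioDM_nonneg 𝒞) (by linarith)
  · have hthird : 1 / 3 ≤ csRatioDM dist 𝒞 := by
      rw [csRatioDM, le_div_iff₀ (h𝒞.sepMin_pos hk2)]
      linarith
    have := mul_le_mul_of_nonneg_left hthird hpos.le
    linarith [E.csRatioDM_le hk2 hkn]
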